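/- Let p = (p_1,…,p_d) be a non-uniform probability distribution with all p_i > 0, let ε ∈ (0,1), let c > 0 (arbitrary if {log p_i} is non-lattice, equal to the lattice span if it is a lattice family), and let 0 < a < c. For k = 0,1,2,… set R_{k,n} = { x⃗ ∈ {1,…,d}^n : n·H(p) + √n·√V(p)·Φ^{−1}(ε) − ck ≥ −log P^n(x⃗) > n·H(p) + √n·√V(p)·Φ^{−1}(ε) − c(k+1) }. Then there exist a constant C and an integer N such that for all n ≥ N, | log ( Σ_{k=0}^{∞} |R_{k,n}|·e^{ka} ) − ( n·H(p) + √n·√V(p)·Φ^{−1}(ε) − (1/2)·log n ) | ≤ C. -/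

import Mathlib

open scoped BigOperators Classical
open Real

/-- Shannon entropy (natural log). -/
noncomputable def shannonH {d : ℕ} (p : Fin d → ℝ) : ℝ :=
  -∑ i, p i * Real.log (p i)

/-- Varentropy `V(p)`. -/
noncomputable def varH {d : ℕ} (p : Fin d → ℝ) : ℝ :=
  ∑ i, p i * (Real.log (p i) + shannonH p) ^ 2

/-- CDF of the standard normal distribution. -/
noncomputable def Phi (x : ℝ) : ℝ :=
  ∫ y in Set.Iic x, Real.exp (-(y ^ 2) / 2) / Real.sqrt (2 * Real.pi)

/-- Inverse of the standard normal CDF. -/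
noncomputable def PhiInv : ℝ → ℝ := Function.invFun Phi

/-- Product probability `P^n(x)` of a string. -/
noncomputable def prodP {d : ℕ} (p : Fin d → ℝ) {n : ℕ} (x : Fin n → Fin d) : ℝ :=
  ∏ k, p (x k)

/-- `c₀` is the lattice span of the family `{log p_i}`: the largest positive real
such that all differences `log p_i − log p_j` lie in `c₀ ⬝ ℤ`. -/
def IsLatticeSpan {d : ℕ} (p : Fin d → ℝ) (c₀ : ℝ) : Prop :=
  0 < c₀ ∧ (∀ i j, ∃ k : ℤ, Real.log (p i) - Real.log (p j) = (k : ℝ) * c₀) ∧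
    ∀ c' : ℝ, 0 < c' →
      (∀ i j, ∃ k : ℤ, Real.log (p i) - Real.log (p j) = (k : ℝ) * c') → c' ≤ c₀

/-- The slab `R_{k,n}` of strings whose self-information lies in the `k`-th window
of width `c` below `n·H(p) + √n·√V(p)·Φ⁻¹(ε)`. -/
noncomputable def Rslab {d : ℕ} (p : Fin d → ℝ) (ε c : ℝ) (n k : ℕ) :
    Finset (Fin n → Fin d) :=
  Finset.univ.filter (fun x =>
    -Real.log (prodP p x)
        ≤ (n : ℝ) * shannonH p + Real.sqrt n * Real.sqrt (varH p) * PhiInv ε - c * k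
      ∧ (n : ℝ) * shannonH p + Real.sqrt n * Real.sqrt (varH p) * PhiInv ε - c * (k + 1)
        < -Real.log (prodP p x))
open Filter Topology MeasureTheory

/-- Characteristic function of the distribution putting mass `p i` at `y i`. -/
noncomputable def discreteCharFun {d : ℕ} (p y : Fin d → ℝ) (t : ℝ) : ℂ :=
  ∑ i, (p i : ℂ) * Complex.exp ((t * y i : ℝ) * Complex.I)

lemma discreteCharFun_pow {d : ℕ} (p y : Fin d → ℝ) (t : ℝ) (n : ℕ) :
    discreteCharFun p y t ^ n = ∑ x : Fin n → Fin d,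
      (prodP p x : ℂ) * Complex.exp ((t * ∑ k, y (x k) : ℝ) * Complex.I) := by
  rw [discreteCharFun, Fintype.sum_pow]
  refine Finset.sum_congr rfl fun x _ => ?_
  rw [Finset.prod_mul_distrib, ← Complex.exp_sum, prodP]
  push_cast
  rw [Finset.mul_sum, Finset.sum_mul]

lemma continuous_discreteCharFun {d : ℕ} (p y : Fin d → ℝ) :
    Continuous (discreteCharFun p y) := by
  unfold discreteCharFun
  fun_prop

lemma norm_discreteCharFun_sq {d : ℕ} (p y : Fin d → ℝ) (t : ℝ) :
    ‖discreteCharFun p y t‖ ^ 2 = ∑ i, ∑ j, p i * p j * Real.cos (t * (y i - y j)) := by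
  have hre : (discreteCharFun p y t).re = ∑ i, p i * Real.cos (t * y i) := by
    rw [discreteCharFun, Complex.re_sum]
    refine Finset.sum_congr rfl fun i _ => ?_
    rw [Complex.re_ofReal_mul, Complex.exp_ofReal_mul_I_re]
  have him : (discreteCharFun p y t).im = ∑ i, p i * Real.sin (t * y i) := by
    rw [discreteCharFun, Complex.im_sum]
    refine Finset.sum_congr rfl fun i _ => ?_
    rw [Complex.im_ofReal_mul, Complex.exp_ofReal_mul_I_im]
  rw [Complex.sq_norm, Complex.normSq_apply, hre, him, Finset.sum_mul_sum, Finset.sum_mul_sum,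
    ← Finset.sum_add_distrib]
  refine Finset.sum_congr rfl fun i _ => ?_
  rw [← Finset.sum_add_distrib]
  refine Finset.sum_congr rfl fun j _ => ?_
  rw [mul_sub, Real.cos_sub]
  ring

lemma norm_discreteCharFun_le {d : ℕ} {p : Fin d → ℝ} (y : Fin d → ℝ)
    (hpos : ∀ i, 0 < p i) (hsum : ∑ i, p i = 1) (i j : Fin d) {t : ℝ}
    (ht : |t * (y i - y j)| ≤ π) :
    ‖discreteCharFun p y t‖ ≤ Real.exp (-(p i * p j * (y i - y j) ^ 2 / π ^ 2) * t ^ 2) := by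
  set q := p i * p j * (2 / π ^ 2 * (t * (y i - y j)) ^ 2) with hq
  have hterm : ∀ a b, 0 ≤ p a * p b * (1 - Real.cos (t * (y a - y b))) := fun a b =>
    mul_nonneg (mul_nonneg (hpos a).le (hpos b).le) (by linarith [Real.cos_le_one (t * (y a - y b))])
  have h1 : 1 - ‖discreteCharFun p y t‖ ^ 2
      = ∑ a, ∑ b, p a * p b * (1 - Real.cos (t * (y a - y b))) := by
    have : (1 : ℝ) = ∑ a, ∑ b, p a * p b := by
      rw [← Finset.sum_mul_sum, hsum, one_mul]
    rw [norm_discreteCharFun_sq]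
    nth_rewrite 1 [this]
    simp only [mul_sub, mul_one, Finset.sum_sub_distrib]
  have h2 : q ≤ 1 - ‖discreteCharFun p y t‖ ^ 2 := by
    rw [h1]
    calc q ≤ p i * p j * (1 - Real.cos (t * (y i - y j))) := by
          refine mul_le_mul_of_nonneg_left ?_ (mul_nonneg (hpos i).le (hpos j).le)
          linarith [Real.cos_le_one_sub_mul_cos_sq ht]
      _ ≤ ∑ b, p i * p b * (1 - Real.cos (t * (y i - y b))) :=
          Finset.single_le_sum (f := fun b => p i * p b * (1 - Real.cos (t * (y i - y b))))
            (fun b _ => hterm i b) (Finset.mem_univ j)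
      _ ≤ _ := Finset.single_le_sum
            (f := fun a => ∑ b, p a * p b * (1 - Real.cos (t * (y a - y b))))
            (fun a _ => Finset.sum_nonneg fun b _ => hterm a b) (Finset.mem_univ i)
  have h3 : ‖discreteCharFun p y t‖ ^ 2 ≤ Real.exp (-q / 2) ^ 2 := by
    rw [← Real.exp_nat_mul]
    have := Real.add_one_le_exp (-q)
    have e : ((2 : ℕ) : ℝ) * (-q / 2) = -q := by push_cast; ring
    rw [e]
    linarith
  have h4 := (sq_le_sq₀ (norm_nonneg _) (Real.exp_pos _).le).1 h3
  refine h4.trans_eq ?_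
  rw [hq]
  congr 1
  field_simp

lemma tendsto_discreteCharFun_pow {d : ℕ} {p y : Fin d → ℝ} (hsum : ∑ i, p i = 1)
    (hmean : ∑ i, p i * y i = 0) (s : ℝ) :
    Tendsto (fun n : ℕ => discreteCharFun p y (s / √n) ^ n) atTop
      (𝓝 (Complex.exp (-((∑ i, p i * y i ^ 2) * s ^ 2 / 2 : ℝ)))) := by
  have key : ∀ z : ℝ, Tendsto (fun n : ℕ => (n : ℂ) *
      (Complex.exp ((z / √n : ℝ) * Complex.I) - 1 - (z / √n : ℝ) * Complex.I)) atTop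
      (𝓝 (-(z ^ 2 / 2 : ℝ))) := by
    intro z
    rw [tendsto_iff_norm_sub_tendsto_zero]
    have hlim : Tendsto (fun n : ℕ => |z| ^ 3 * Real.exp |z| * (√n)⁻¹) atTop (𝓝 0) := by
      rw [← mul_zero (|z| ^ 3 * Real.exp |z|)]
      exact (tendsto_inv_atTop_zero.comp
        (Real.tendsto_sqrt_atTop.comp tendsto_natCast_atTop_atTop)).const_mul _
    refine squeeze_zero' (Eventually.of_forall fun _ => norm_nonneg _) ?_ hlim
    filter_upwards [eventually_ge_atTop 1] with n hn
    have hn' : (1 : ℝ) ≤ n := by exact_mod_cast hn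
    have hs1 : 1 ≤ √(n : ℝ) := Real.one_le_sqrt.2 hn'
    have hs0 : 0 < √(n : ℝ) := by linarith
    have hss : √(n : ℝ) ^ 2 = n := Real.sq_sqrt (by linarith)
    have hsc : ((√(n : ℝ) : ℝ) : ℂ) ^ 2 = n := by exact_mod_cast hss
    have hsc0 : ((√(n : ℝ) : ℝ) : ℂ) ≠ 0 := by exact_mod_cast hs0.ne'
    have hb := Complex.norm_exp_sub_sum_le_norm_mul_exp ((z / √n : ℝ) * Complex.I) 3
    have hnorm : ‖((z / √n : ℝ) : ℂ) * Complex.I‖ = |z| / √n := by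
      rw [norm_mul, Complex.norm_I, mul_one, Complex.norm_real, Real.norm_eq_abs, abs_div,
        abs_of_pos hs0]
    rw [hnorm] at hb
    have e : (n : ℂ) * (Complex.exp ((z / √n : ℝ) * Complex.I) - 1 - (z / √n : ℝ) * Complex.I)
        - -((z ^ 2 / 2 : ℝ) : ℂ) = n * (Complex.exp ((z / √n : ℝ) * Complex.I)
        - ∑ m ∈ Finset.range 3, ((z / √n : ℝ) * Complex.I) ^ m / m.factorial) := by
      simp only [Finset.sum_range_succ, Finset.sum_range_zero, Nat.factorial]
      push_cast
      rw [← hsc, mul_pow _ _ 2, Complex.I_sq]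
      field_simp
      ring
    rw [e, norm_mul, Complex.norm_natCast]
    calc (n : ℝ) * _ ≤ n * ((|z| / √n) ^ 3 * Real.exp (|z| / √n)) := by gcongr
      _ ≤ n * ((|z| / √n) ^ 3 * Real.exp |z|) := by
          gcongr
          exact div_le_self (abs_nonneg _) hs1
      _ = _ := by
          nth_rewrite 1 [← hss]
          field_simp
  have hconv : Tendsto (fun n : ℕ => (n : ℂ) * (discreteCharFun p y (s / √n) - 1)) atTop
      (𝓝 (-((∑ i, p i * y i ^ 2) * s ^ 2 / 2 : ℝ))) := by
    have h := tendsto_finsetSum (Finset.univ : Finset (Fin d))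
      fun i _ => (key (s * y i)).const_mul (p i : ℂ)
    convert h using 1
    · ext n
      have h1 : (1 : ℂ) = ∑ i, (p i : ℂ) := by exact_mod_cast hsum.symm
      have h2 : ∑ i, (p i : ℂ) * ((s * y i / √n : ℝ) * Complex.I) = 0 := by
        have : ∑ i, (p i : ℂ) * ((s * y i / √n : ℝ) * Complex.I)
            = ((∑ i, p i * y i : ℝ) : ℂ) * (s / √n * Complex.I) := by
          push_cast
          rw [Finset.sum_mul]
          exact Finset.sum_congr rfl fun i _ => by ring
        rw [this, hmean]
        simp
      have h3 : discreteCharFun p y (s / √n) - 1 = ∑ i, (p i : ℂ) *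
          (Complex.exp ((s * y i / √n : ℝ) * Complex.I) - 1 - (s * y i / √n : ℝ) * Complex.I) := by
        simp only [mul_sub, Finset.sum_sub_distrib, mul_one]
        rw [h2, ← h1, sub_zero, discreteCharFun]
        simp only [div_mul_eq_mul_div]
      rw [h3, Finset.mul_sum]
      exact Finset.sum_congr rfl fun i _ => by ring
    · congr 1
      push_cast
      rw [Finset.sum_mul, Finset.sum_div, ← Finset.sum_neg_distrib]
      exact Finset.sum_congr rfl fun i _ => by ring
  have := Complex.tendsto_one_add_pow_exp_of_tendsto hconv
  simpa using this

/-- Fourier transform of `(1 - |t|)²` on `[-1, 1]`, a nonnegative kernel decaying exactly like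
`4 / x²`. -/
noncomputable def quadKernel (x : ℝ) : ℝ := 2 * ∫ t in (0 : ℝ)..1, (1 - t) ^ 2 * Real.cos (t * x)

lemma quadKernel_eq {x : ℝ} (hx : x ≠ 0) : quadKernel x = 4 * (x - Real.sin x) / x ^ 3 := by
  have h : ∀ t ∈ Set.uIcc (0 : ℝ) 1, HasDerivAt
      (fun t : ℝ => (1 - t) ^ 2 * Real.sin (t * x) / x - 2 * (1 - t) * Real.cos (t * x) / x ^ 2
        - 2 * Real.sin (t * x) / x ^ 3) ((1 - t) ^ 2 * Real.cos (t * x)) t := by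
    intro t _
    have h0 : HasDerivAt (fun t : ℝ => t * x) x t := by simpa using (hasDerivAt_id t).mul_const x
    have hl : HasDerivAt (fun t : ℝ => 1 - t) (-1) t := by simpa using (hasDerivAt_id t).const_sub 1
    have hs := h0.sin
    have hc := h0.cos
    refine HasDerivAt.congr_deriv ((((hl.fun_pow 2).fun_mul hs).div_const x).fun_sub
      (((hl.const_mul 2).fun_mul hc).div_const (x ^ 2)) |>.fun_sub
        ((hs.const_mul 2).div_const (x ^ 3))) ?_
    field_simp
    ring
  rw [quadKernel, intervalIntegral.integral_eq_sub_of_hasDerivAt h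
    ((by fun_prop : Continuous fun t : ℝ => (1 - t) ^ 2 * Real.cos (t * x)).intervalIntegrable 0 1)]
  simp
  field_simp
  ring

lemma quadKernel_le_two (x : ℝ) : quadKernel x ≤ 2 := by
  have h := intervalIntegral.norm_integral_le_of_norm_le_const (a := 0) (b := 1) (C := 1)
    (f := fun t : ℝ => (1 - t) ^ 2 * Real.cos (t * x)) (by
      intro t ht
      rw [Set.uIoc_of_le zero_le_one] at ht
      rw [norm_mul, norm_pow, Real.norm_eq_abs, Real.norm_eq_abs, sq_abs]
      exact mul_le_one₀ (by nlinarith [ht.1, ht.2]) (abs_nonneg _) (Real.abs_cos_le_one _))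
  have := le_of_abs_le h
  rw [quadKernel]
  norm_num at this
  linarith

lemma quadKernel_neg (x : ℝ) : quadKernel (-x) = quadKernel x := by
  simp [quadKernel]

lemma quadKernel_abs (x : ℝ) : quadKernel |x| = quadKernel x := by
  rcases abs_choice x with h | h <;> rw [h]
  exact quadKernel_neg x

lemma quadKernel_nonneg (x : ℝ) : 0 ≤ quadKernel x := by
  rcases eq_or_ne x 0 with rfl | hx
  · simp only [quadKernel, mul_zero, Real.cos_zero, mul_one]
    exact mul_nonneg zero_le_two (intervalIntegral.integral_nonneg zero_le_one fun t _ => sq_nonneg _)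
  · have hx' := abs_pos.2 hx
    rw [← quadKernel_abs, quadKernel_eq hx'.ne']
    have := Real.sin_le hx'.le
    have : 0 ≤ |x| - Real.sin |x| := by linarith
    positivity

lemma two_div_sq_le_quadKernel {x : ℝ} (hx : 2 ≤ |x|) : 2 / x ^ 2 ≤ quadKernel x := by
  have h0 : 0 < |x| := by linarith
  rw [← quadKernel_abs, quadKernel_eq h0.ne', ← sq_abs, div_le_div_iff₀ (by positivity) (by positivity)]
  have := Real.sin_le_one |x|
  have h : |x| ≤ 2 * (|x| - Real.sin |x|) := by linarith
  nlinarith [sq_nonneg |x|, mul_le_mul_of_nonneg_left h (sq_nonneg |x|)]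

lemma quadKernel_le_div_sq {x : ℝ} (hx : 2 ≤ |x|) : quadKernel x ≤ 8 / x ^ 2 := by
  have h0 : 0 < |x| := by linarith
  rw [← quadKernel_abs, quadKernel_eq h0.ne', ← sq_abs x,
    div_le_div_iff₀ (by positivity) (by positivity)]
  have := Real.neg_one_le_sin |x|
  have h : |x| - Real.sin |x| ≤ 2 * |x| := by linarith
  nlinarith [sq_nonneg |x|, mul_le_mul_of_nonneg_left h (sq_nonneg |x|)]

lemma quadKernel_tail_le {x m : ℝ} (hm : 1 ≤ m) (hx : 2 * m ≤ |x|) :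
    quadKernel x ≤ 4 / m ^ 2 * quadKernel (x / m) := by
  have hm0 : 0 < m := by linarith
  have h1 : 2 ≤ |x / m| := by
    rw [abs_div, abs_of_pos hm0, le_div_iff₀ hm0]
    exact hx
  have hx0 : x ≠ 0 := by
    rintro rfl
    simp at hx
    linarith
  calc quadKernel x ≤ 8 / x ^ 2 := quadKernel_le_div_sq (by linarith)
    _ = 4 / m ^ 2 * (2 / (x / m) ^ 2) := by field_simp; norm_num
    _ ≤ _ := by gcongr; exact two_div_sq_le_quadKernel h1

/-- Expectation of the rescaled kernel at the i.i.d. sum of the `y`-values. -/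
noncomputable def smoothedMean {d : ℕ} (p y : Fin d → ℝ) (n : ℕ) (δ u : ℝ) : ℝ :=
  ∑ x : Fin n → Fin d, prodP p x * quadKernel (δ * (∑ k, y (x k) - u))

lemma smoothedMean_eq {d : ℕ} (p y : Fin d → ℝ) (n : ℕ) (δ u : ℝ) :
    smoothedMean p y n δ u = 2 * ∫ t in (0 : ℝ)..1, (1 - t) ^ 2 *
      (Complex.exp ((-(t * (δ * u)) : ℝ) * Complex.I) * discreteCharFun p y (δ * t) ^ n).re := by
  have h : ∀ t : ℝ, (1 - t) ^ 2 *
      (Complex.exp ((-(t * (δ * u)) : ℝ) * Complex.I) * discreteCharFun p y (δ * t) ^ n).re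
      = ∑ x : Fin n → Fin d,
        prodP p x * ((1 - t) ^ 2 * Real.cos (t * (δ * (∑ k, y (x k) - u)))) := by
    intro t
    rw [discreteCharFun_pow, Finset.mul_sum, Complex.re_sum, Finset.mul_sum]
    refine Finset.sum_congr rfl fun x _ => ?_
    rw [mul_left_comm, ← Complex.exp_add, ← add_mul, ← Complex.ofReal_add, Complex.re_ofReal_mul,
      Complex.exp_ofReal_mul_I_re, mul_left_comm]
    congr 4
    ring
  simp only [h]
  rw [intervalIntegral.integral_finsetSum fun x _ =>
    (by fun_prop : Continuous fun t : ℝ => prodP p x *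
      ((1 - t) ^ 2 * Real.cos (t * (δ * (∑ k, y (x k) - u))))).intervalIntegrable 0 1]
  rw [smoothedMean, Finset.mul_sum]
  refine Finset.sum_congr rfl fun x _ => ?_
  rw [intervalIntegral.integral_const_mul, quadKernel]
  ring

lemma norm_pow_le_exp {d : ℕ} {p y : Fin d → ℝ} {κ δ : ℝ}
    (hcf : ∀ t, 0 ≤ t → t ≤ δ → ‖discreteCharFun p y t‖ ≤ Real.exp (-κ * t ^ 2))
    (n : ℕ) {t : ℝ} (h0 : 0 ≤ t) (h1 : t ≤ δ) :
    ‖discreteCharFun p y t ^ n‖ ≤ Real.exp (-κ * n * t ^ 2) := by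
  rw [norm_pow]
  calc _ ≤ Real.exp (-κ * t ^ 2) ^ n := by gcongr; exact hcf t h0 h1
    _ = _ := by rw [← Real.exp_nat_mul]; congr 1; ring

lemma abs_smoothedMean_integrand_le {d : ℕ} {p y : Fin d → ℝ} {κ δ : ℝ} (hδ : 0 ≤ δ)
    (hcf : ∀ t, 0 ≤ t → t ≤ δ → ‖discreteCharFun p y t‖ ≤ Real.exp (-κ * t ^ 2))
    (n : ℕ) (z : ℝ) {t : ℝ} (h0 : 0 ≤ t) (h1 : t ≤ 1) :
    |(1 - t) ^ 2 * (Complex.exp (z * Complex.I) * discreteCharFun p y (δ * t) ^ n).re|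
      ≤ Real.exp (-(κ * δ ^ 2 * n) * t ^ 2) := by
  rw [abs_mul, abs_of_nonneg (sq_nonneg _)]
  calc _ ≤ 1 * ‖Complex.exp (z * Complex.I) * discreteCharFun p y (δ * t) ^ n‖ := by
        gcongr
        · nlinarith
        · exact Complex.abs_re_le_norm _
    _ = ‖discreteCharFun p y (δ * t) ^ n‖ := by
        rw [one_mul, norm_mul, Complex.norm_exp_ofReal_mul_I, one_mul]
    _ ≤ _ := norm_pow_le_exp hcf n (by positivity) (mul_le_of_le_one_right hδ h1)
    _ = _ := by congr 1; ring

lemma smoothedMean_le {d : ℕ} {p y : Fin d → ℝ} {κ δ : ℝ} (hκ : 0 < κ) (hδ : 0 < δ)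
    (hcf : ∀ t, 0 ≤ t → t ≤ δ → ‖discreteCharFun p y t‖ ≤ Real.exp (-κ * t ^ 2))
    {n : ℕ} (hn : 1 ≤ n) (u : ℝ) :
    smoothedMean p y n δ u ≤ √(π / κ) / δ / √n := by
  have hn' : (0 : ℝ) < n := by exact_mod_cast hn
  have hb : 0 < κ * δ ^ 2 * n := by positivity
  have hcont := continuous_discreteCharFun p y
  have hint := (integrable_exp_neg_mul_sq hb).integrableOn (s := Set.Ioi 0)
  rw [smoothedMean_eq]
  have h1 : ∫ t in (0 : ℝ)..1, (1 - t) ^ 2 *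
      (Complex.exp ((-(t * (δ * u)) : ℝ) * Complex.I) * discreteCharFun p y (δ * t) ^ n).re
      ≤ ∫ t in (0 : ℝ)..1, Real.exp (-(κ * δ ^ 2 * n) * t ^ 2) := by
    refine intervalIntegral.integral_mono_on zero_le_one
      (Continuous.intervalIntegrable (by fun_prop) _ _)
      (Continuous.intervalIntegrable (by fun_prop) _ _) fun t ht => ?_
    exact (le_abs_self _).trans (abs_smoothedMean_integrand_le hδ.le hcf n _ ht.1 ht.2)
  have h2 : ∫ t in (0 : ℝ)..1, Real.exp (-(κ * δ ^ 2 * n) * t ^ 2)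
      ≤ √(π / (κ * δ ^ 2 * n)) / 2 := by
    rw [intervalIntegral.integral_of_le zero_le_one, ← integral_gaussian_Ioi]
    exact setIntegral_mono_set hint (Eventually.of_forall fun t => (Real.exp_pos _).le)
      (Eventually.of_forall fun t ht => ht.1)
  have h3 : √(π / (κ * δ ^ 2 * n)) = √(π / κ) / δ / √n := by
    rw [div_div, ← Real.sqrt_sq hδ.le, ← Real.sqrt_mul (by positivity), ← Real.sqrt_div (by positivity),
      Real.sq_sqrt (by positivity)]
    congr 1
    field_simp
  linarith

lemma integral_cos_mul_exp_pos {γ : ℝ} (hγ : 0 < γ) (β : ℝ) :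
    0 < ∫ s in Set.Ioi (0 : ℝ), Real.cos (s * β) * Real.exp (-γ * s ^ 2) := by
  have h1 : ∫ s : ℝ, Real.cos (s * β) * Real.exp (-γ * s ^ 2)
      = 2 * ∫ s in Set.Ioi (0 : ℝ), Real.cos (s * β) * Real.exp (-γ * s ^ 2) := by
    rw [← integral_comp_abs (f := fun s => Real.cos (s * β) * Real.exp (-γ * s ^ 2))]
    refine integral_congr_ae (Eventually.of_forall fun s => ?_)
    rcases abs_choice s with h | h <;> simp [h]
  have hγ' : 0 < (γ : ℂ).re := by simpa using hγ
  have h2 := fourierIntegral_gaussian hγ' β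
  have hint : Integrable fun s : ℝ =>
      Complex.exp (Complex.I * β * s) * Complex.exp (-γ * (s : ℂ) ^ 2) := by
    refine (integrable_exp_neg_mul_sq hγ).mono' (by fun_prop) (Eventually.of_forall fun s => ?_)
    rw [norm_mul, Complex.norm_exp, Complex.norm_exp]
    have : ((s : ℂ) ^ 2).re = s ^ 2 := by norm_cast
    simp [this]
  have h3 : ∫ s : ℝ, Real.cos (s * β) * Real.exp (-γ * s ^ 2)
      = √(π / γ) * Real.exp (-β ^ 2 / (4 * γ)) := by
    have hR : (π / γ : ℂ) ^ (1 / 2 : ℂ) * Complex.exp (-(β : ℂ) ^ 2 / (4 * γ))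
        = ((√(π / γ) * Real.exp (-β ^ 2 / (4 * γ)) : ℝ) : ℂ) := by
      rw [Real.sqrt_eq_rpow]
      push_cast [Complex.ofReal_cpow (div_pos Real.pi_pos hγ).le]
      rfl
    have hre := integral_re hint
    rw [h2, hR] at hre
    refine Eq.trans ?_ (hre.trans (Complex.ofReal_re _))
    refine integral_congr_ae (Eventually.of_forall fun s => ?_)
    have e1 : Complex.I * β * s = ((s * β : ℝ) : ℂ) * Complex.I := by push_cast; ring
    have e2 : Complex.exp (-γ * (s : ℂ) ^ 2) = ((Real.exp (-γ * s ^ 2) : ℝ) : ℂ) := by push_cast; rfl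
    simp only [e1, e2]
    exact ((Complex.re_mul_ofReal _ _).trans (by rw [Complex.exp_ofReal_mul_I_re])).symm
  have : 0 < √(π / γ) * Real.exp (-β ^ 2 / (4 * γ)) := by positivity
  linarith

lemma tendsto_smoothedMean {d : ℕ} {p y : Fin d → ℝ} (hsum : ∑ i, p i = 1)
    (hmean : ∑ i, p i * y i = 0) {κ δ : ℝ} (hκ : 0 < κ) (hδ : 0 < δ)
    (hcf : ∀ t, 0 ≤ t → t ≤ δ → ‖discreteCharFun p y t‖ ≤ Real.exp (-κ * t ^ 2)) (b r : ℝ) :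
    Tendsto (fun n : ℕ => √n * smoothedMean p y n δ (√n * b - r)) atTop
      (𝓝 (2 * ∫ s in Set.Ioi (0 : ℝ), Real.cos (s * (δ * b)) *
        Real.exp (-((∑ i, p i * y i ^ 2) * δ ^ 2 / 2) * s ^ 2))) := by
  set V := ∑ i, p i * y i ^ 2 with hV
  have hcont := continuous_discreteCharFun p y
  set g : ℕ → ℝ → ℝ := fun n t => (1 - t) ^ 2 *
    (Complex.exp ((-(t * (δ * (√n * b - r))) : ℝ) * Complex.I)
      * discreteCharFun p y (δ * t) ^ n).re with hg
  have hgc : ∀ n, Continuous (g n) := fun n => by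
    simp only [hg]
    fun_prop
  have hlim : Tendsto (fun n : ℕ => ∫ s in Set.Ioi (0 : ℝ),
      (Set.Iic √(n : ℝ)).indicator (fun s => g n (s / √n)) s) atTop
      (𝓝 (∫ s in Set.Ioi (0 : ℝ), Real.cos (s * (δ * b)) * Real.exp (-(V * δ ^ 2 / 2) * s ^ 2))) := by
    refine tendsto_integral_filter_of_dominated_convergence
      (fun s => Real.exp (-(κ * δ ^ 2) * s ^ 2)) ?_ ?_ ?_ ?_
    · refine Eventually.of_forall fun n => ?_
      exact ((hgc n).comp (continuous_id.div_const _)).aestronglyMeasurable.indicator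
        measurableSet_Iic
    · filter_upwards [eventually_ge_atTop 1] with n hn
      have hn' : (0 : ℝ) < n := by exact_mod_cast hn
      have hs : 0 < √(n : ℝ) := Real.sqrt_pos.2 hn'
      filter_upwards [ae_restrict_mem measurableSet_Ioi] with s hs0
      by_cases hsn : s ∈ Set.Iic √(n : ℝ)
      · rw [Set.indicator_of_mem hsn, Real.norm_eq_abs]
        refine (abs_smoothedMean_integrand_le hδ.le hcf n _ (div_nonneg (le_of_lt hs0) hs.le)
          ((div_le_one hs).2 hsn)).trans_eq ?_
        rw [div_pow, Real.sq_sqrt hn'.le]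
        congr 1
        field_simp
      · rw [Set.indicator_of_notMem hsn, norm_zero]
        exact (Real.exp_pos _).le
    · exact (integrable_exp_neg_mul_sq (by positivity)).integrableOn
    · filter_upwards [ae_restrict_mem measurableSet_Ioi] with s hs0
      have hinv : Tendsto (fun n : ℕ => (√(n : ℝ))⁻¹) atTop (𝓝 0) :=
        tendsto_inv_atTop_zero.comp (Real.tendsto_sqrt_atTop.comp tendsto_natCast_atTop_atTop)
      have hA : Tendsto (fun n : ℕ => (1 - s / √(n : ℝ)) ^ 2) atTop (𝓝 1) := by
        have := ((hinv.const_mul s).const_sub 1).pow 2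
        simpa [div_eq_mul_inv] using this
      have hB : Tendsto (fun n : ℕ => -(s / √(n : ℝ) * (δ * (√n * b - r)))) atTop
          (𝓝 (-(s * (δ * b)))) := by
        have h1 : Tendsto (fun n : ℕ => -(s * (δ * b)) + s * (δ * r) * (√(n : ℝ))⁻¹) atTop
            (𝓝 (-(s * (δ * b)))) := by
          simpa using (hinv.const_mul (s * (δ * r))).const_add (-(s * (δ * b)))
        refine h1.congr' ?_
        filter_upwards [eventually_ge_atTop 1] with n hn
        have hn' : (0 : ℝ) < n := by exact_mod_cast hn
        have hs : √(n : ℝ) ≠ 0 := (Real.sqrt_pos.2 hn').ne'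
        field_simp
        ring
      have hC : Tendsto (fun n : ℕ => discreteCharFun p y (δ * (s / √n)) ^ n) atTop
          (𝓝 (Complex.exp (-(V * (δ * s) ^ 2 / 2 : ℝ)))) := by
        simpa only [mul_div_assoc] using tendsto_discreteCharFun_pow hsum hmean (δ * s)
      have hD : Tendsto (fun n : ℕ =>
          Complex.exp ((-(s / √(n : ℝ) * (δ * (√n * b - r))) : ℝ) * Complex.I)) atTop
          (𝓝 (Complex.exp ((-(s * (δ * b)) : ℝ) * Complex.I))) :=
        ((by fun_prop : Continuous fun z : ℝ => Complex.exp ((z : ℝ) * Complex.I)).tendsto _).comp hB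
      have hE := hA.mul ((Complex.continuous_re.tendsto _).comp (hD.mul hC))
      have hval : 1 * (Complex.exp ((-(s * (δ * b)) : ℝ) * Complex.I) *
          Complex.exp (-(V * (δ * s) ^ 2 / 2 : ℝ))).re
          = Real.cos (s * (δ * b)) * Real.exp (-(V * δ ^ 2 / 2) * s ^ 2) := by
        rw [one_mul, ← Complex.ofReal_neg (V * _ / 2), ← Complex.ofReal_exp, Complex.re_mul_ofReal,
          Complex.exp_ofReal_mul_I_re, Real.cos_neg]
        congr 2
        ring
      rw [hval] at hE
      refine hE.congr' ?_
      filter_upwards [(Real.tendsto_sqrt_atTop.comp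
        tendsto_natCast_atTop_atTop).eventually_ge_atTop s] with n hn
      rw [Set.indicator_of_mem (show s ∈ Set.Iic √(n : ℝ) from hn)]
      rfl
  refine (hlim.const_mul 2).congr' ?_
  filter_upwards [eventually_ge_atTop 1] with n hn
  have hn' : (0 : ℝ) < n := by exact_mod_cast hn
  have hs : 0 < √(n : ℝ) := Real.sqrt_pos.2 hn'
  rw [smoothedMean_eq, setIntegral_indicator measurableSet_Iic, Set.Ioi_inter_Iic,
    ← intervalIntegral.integral_of_le hs.le, intervalIntegral.integral_comp_div (g n) hs.ne',
    zero_div, div_self hs.ne', smul_eq_mul]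
  ring

lemma prodP_pos {d : ℕ} {p : Fin d → ℝ} (hpos : ∀ i, 0 < p i) {n : ℕ} (x : Fin n → Fin d) :
    0 < prodP p x := Finset.prod_pos fun _ _ => hpos _

lemma sum_prodP_le_of_mem_window {d : ℕ} {p y : Fin d → ℝ} (hpos : ∀ i, 0 < p i) {κ δ w : ℝ}
    (hκ : 0 < κ) (hδ : 0 < δ) (hw : 0 < w)
    (hcf : ∀ t, 0 ≤ t → t ≤ δ → ‖discreteCharFun p y t‖ ≤ Real.exp (-κ * t ^ 2)) :
    ∃ A, 0 < A ∧ ∀ n : ℕ, 1 ≤ n → ∀ (u : ℝ) (s : Finset (Fin n → Fin d)),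
      (∀ x ∈ s, u ≤ ∑ k, y (x k) ∧ ∑ k, y (x k) ≤ u + w) →
      ∑ x ∈ s, prodP p x ≤ A / √n := by
  refine ⟨(2 + δ * w) ^ 2 / 2 * (√(π / κ) / δ), by positivity, fun n hn u s hs => ?_⟩
  calc ∑ x ∈ s, prodP p x
      ≤ ∑ x ∈ s, (2 + δ * w) ^ 2 / 2 *
          (prodP p x * quadKernel (δ * (∑ k, y (x k) - (u - 2 / δ)))) := by
        refine Finset.sum_le_sum fun x hx => ?_
        obtain ⟨h1, h2⟩ := hs x hx
        set z := δ * (∑ k, y (x k) - (u - 2 / δ)) with hz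
        have hz' : z = δ * (∑ k, y (x k) - u) + 2 := by rw [hz]; field_simp; ring
        have hz2 : 2 ≤ z := by
          rw [hz']
          nlinarith [mul_nonneg hδ.le (sub_nonneg.2 h1)]
        have hzw : z ≤ 2 + δ * w := by
          rw [hz']
          nlinarith [mul_le_mul_of_nonneg_left h2 hδ.le]
        have hk : 2 / z ^ 2 ≤ quadKernel z :=
          two_div_sq_le_quadKernel (hz2.trans (le_abs_self z))
        have hone : 1 ≤ (2 + δ * w) ^ 2 / 2 * quadKernel z := by
          calc (1 : ℝ) = z ^ 2 / 2 * (2 / z ^ 2) := by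
                have : z ≠ 0 := by linarith
                field_simp
            _ ≤ _ := by gcongr
        have := mul_le_mul_of_nonneg_left hone (prodP_pos hpos x).le
        linarith
    _ ≤ ∑ x, (2 + δ * w) ^ 2 / 2 *
          (prodP p x * quadKernel (δ * (∑ k, y (x k) - (u - 2 / δ)))) :=
        Finset.sum_le_univ_sum_of_nonneg fun x => mul_nonneg (by positivity)
          (mul_nonneg (prodP_pos hpos x).le (quadKernel_nonneg _))
    _ = (2 + δ * w) ^ 2 / 2 * smoothedMean p y n δ (u - 2 / δ) := by
        rw [smoothedMean, Finset.mul_sum]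
    _ ≤ (2 + δ * w) ^ 2 / 2 * (√(π / κ) / δ / √n) := by
        gcongr
        exact smoothedMean_le hκ hδ hcf hn _
    _ = _ := by ring

lemma exists_le_sum_prodP_window {d : ℕ} {p y : Fin d → ℝ} (hpos : ∀ i, 0 < p i)
    (hsum : ∑ i, p i = 1) (hmean : ∑ i, p i * y i = 0) (hvar : 0 < ∑ i, p i * y i ^ 2) {κ δ : ℝ}
    (hκ : 0 < κ) (hδ : 0 < δ)
    (hcf : ∀ t, 0 ≤ t → t ≤ δ → ‖discreteCharFun p y t‖ ≤ Real.exp (-κ * t ^ 2)) (b : ℝ) :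
    ∃ w g : ℝ, 0 < w ∧ 0 < g ∧ ∃ N : ℕ, ∀ n ≥ N, g / √n ≤
      ∑ x : Fin n → Fin d with √n * b - w ≤ ∑ k, y (x k) ∧ ∑ k, y (x k) ≤ √n * b, prodP p x := by
  set G := 2 * ∫ s in Set.Ioi (0 : ℝ), Real.cos (s * (δ * b)) *
        Real.exp (-((∑ i, p i * y i ^ 2) * δ ^ 2 / 2) * s ^ 2) with hG
  have hG0 : 0 < G := mul_pos two_pos (integral_cos_mul_exp_pos (by positivity) _)
  set A := √(π / κ) / δ with hA
  have hA0 : 0 < A := by positivity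
  set m := max 1 (16 * A / G) with hm
  have hm1 : 1 ≤ m := le_max_left _ _
  have hm0 : 0 < m := by linarith
  have hmA : 4 * A / m ≤ G / 4 := by
    have := le_max_right 1 (16 * A / G)
    rw [← hm, div_le_iff₀ hG0] at this
    rw [div_le_iff₀ hm0]
    linarith
  have hlim := tendsto_smoothedMean hsum hmean hκ hδ hcf b (2 * m / δ)
  rw [← hG] at hlim
  obtain ⟨N, hN⟩ := eventually_atTop.1 (hlim.eventually (lt_mem_nhds (half_lt_self hG0)))
  refine ⟨4 * m / δ, G / 8, by positivity, by positivity, max N 1, fun n hn => ?_⟩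
  have hn1 : 1 ≤ n := (le_max_right _ _).trans hn
  have hs : 0 < √(n : ℝ) := Real.sqrt_pos.2 (by exact_mod_cast hn1)
  have hlow := hN n ((le_max_left _ _).trans hn)
  set u := √(n : ℝ) * b - 2 * m / δ with hu
  have htail : smoothedMean p y n (δ / m) u ≤ A * m / √n := by
    have := smoothedMean_le hκ (div_pos hδ hm0) (fun t h0 h1 => hcf t h0
      (h1.trans (div_le_self hδ.le hm1))) hn1 u
    refine this.trans_eq ?_
    rw [hA]
    field_simp
  set s : Finset (Fin n → Fin d) :=
    {x | √n * b - 4 * m / δ ≤ ∑ k, y (x k) ∧ ∑ k, y (x k) ≤ √n * b} with hsdef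
  have hsplit : smoothedMean p y n δ u
      ≤ 2 * ∑ x ∈ s, prodP p x + 4 / m ^ 2 * smoothedMean p y n (δ / m) u := by
    have e : 2 * ∑ x ∈ s, prodP p x = ∑ x, if x ∈ s then 2 * prodP p x else 0 := by
      rw [Finset.mul_sum, Finset.sum_ite_mem, Finset.univ_inter]
    rw [e, smoothedMean, smoothedMean, Finset.mul_sum, ← Finset.sum_add_distrib]
    refine Finset.sum_le_sum fun x _ => ?_
    have hp := prodP_pos hpos x
    have hk0 := quadKernel_nonneg (δ / m * (∑ k, y (x k) - u))
    split_ifs with hx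
    · have := quadKernel_le_two (δ * (∑ k, y (x k) - u))
      have h1 := mul_le_mul_of_nonneg_left this hp.le
      have h2 : 0 ≤ 4 / m ^ 2 * (prodP p x * quadKernel (δ / m * (∑ k, y (x k) - u))) := by
        positivity
      linarith
    · have hbig : 2 * m ≤ |δ * (∑ k, y (x k) - u)| := by
        by_contra! hlt
        apply hx
        rw [abs_lt] at hlt
        have h1 : δ * u = δ * (√n * b) - 2 * m := by rw [hu]; field_simp
        have h2 : δ * (√n * b - 4 * m / δ) = δ * (√n * b) - 4 * m := by field_simp
        simp only [hsdef, Finset.mem_filter, Finset.mem_univ, true_and]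
        constructor
        · refine le_of_mul_le_mul_left ?_ hδ
          rw [h2]
          linarith [hlt.1, mul_sub δ (∑ k, y (x k)) u]
        · refine le_of_mul_le_mul_left ?_ hδ
          linarith [hlt.2, mul_sub δ (∑ k, y (x k)) u]
      have h := mul_le_mul_of_nonneg_left (quadKernel_tail_le hm1 hbig) hp.le
      rw [mul_div_right_comm δ _ m, mul_left_comm] at h
      linarith
  have h4 : 4 / m ^ 2 * smoothedMean p y n (δ / m) u ≤ 4 * A / m / √n := by
    calc _ ≤ 4 / m ^ 2 * (A * m / √n) := by gcongr
      _ = _ := by field_simp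
  have h5 : 4 * A / m / √n ≤ G / 4 / √n := by gcongr
  have h6 : G / 2 / √n < smoothedMean p y n δ u := by
    rw [div_lt_iff₀ hs]
    linarith
  have h7 : G / 8 / √n = (G / 2 / √n - G / 4 / √n) / 2 := by ring
  linarith

lemma neg_log_prodP {d : ℕ} {p : Fin d → ℝ} (hpos : ∀ i, 0 < p i) {n : ℕ} (x : Fin n → Fin d) :
    -Real.log (prodP p x) = n * shannonH p + ∑ k, (-Real.log (p (x k)) - shannonH p) := by
  rw [prodP, Real.log_prod fun k _ => (hpos _).ne', Finset.sum_sub_distrib, Finset.sum_neg_distrib]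
  simp

theorem stmt15 {d : ℕ} (p : Fin d → ℝ)
    (hpos : ∀ i, 0 < p i) (hsum : ∑ i, p i = 1)
    (hnonunif : ∃ i j, p i ≠ p j)
    (ε : ℝ) (hε : ε ∈ Set.Ioo (0 : ℝ) 1)
    (c : ℝ) (hc : 0 < c)
    (hlat : (∀ c₀ : ℝ, ¬ IsLatticeSpan p c₀) ∨ IsLatticeSpan p c)
    (a : ℝ) (ha0 : 0 < a) (hac : a < c) :
    ∃ (C : ℝ) (N : ℕ), ∀ n ≥ N,
      |Real.log (∑' k : ℕ, ((Rslab p ε c n k).card : ℝ) * Real.exp (k * a)) -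
        ((n : ℝ) * shannonH p + Real.sqrt n * Real.sqrt (varH p) * PhiInv ε
          - (1 / 2) * Real.log n)| ≤ C := by
  set H := shannonH p with hH
  set b := √(varH p) * PhiInv ε with hb
  set y : Fin d → ℝ := fun i => -Real.log (p i) - H with hy
  obtain ⟨i, j, hij⟩ := hnonunif
  have hyij : y i - y j ≠ 0 := by
    intro h
    refine hij (Real.log_injOn_pos (hpos i) (hpos j) ?_)
    simp only [hy] at h
    linarith
  have hmean : ∑ i, p i * y i = 0 := by
    simp only [hy, mul_sub, mul_neg, Finset.sum_sub_distrib, Finset.sum_neg_distrib,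
      ← Finset.sum_mul, hsum, one_mul]
    exact sub_self _
  have hvar : 0 < ∑ i, p i * y i ^ 2 := by
    have hnn : ∀ k ∈ Finset.univ, 0 ≤ p k * y k ^ 2 := fun k _ =>
      mul_nonneg (hpos k).le (sq_nonneg _)
    refine lt_of_le_of_ne (Finset.sum_nonneg hnn) fun h => hyij ?_
    have h0 := (Finset.sum_eq_zero_iff_of_nonneg hnn).1 h.symm
    have hz : ∀ k, y k = 0 := fun k => by simpa [(hpos k).ne'] using h0 k (Finset.mem_univ k)
    rw [hz, hz, sub_self]
  set δ := π / |y i - y j| with hδ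
  have hδ0 : 0 < δ := div_pos Real.pi_pos (abs_pos.2 hyij)
  set κ := p i * p j * (y i - y j) ^ 2 / π ^ 2 with hκ
  have hκ0 : 0 < κ := by
    have := hpos i
    have := hpos j
    positivity
  have hcf : ∀ t, 0 ≤ t → t ≤ δ → ‖discreteCharFun p y t‖ ≤ Real.exp (-κ * t ^ 2) := by
    intro t h0 h1
    refine norm_discreteCharFun_le y hpos hsum i j ?_
    rw [abs_mul, abs_of_nonneg h0]
    exact (le_div_iff₀ (abs_pos.2 hyij)).1 h1
  obtain ⟨A, hA0, hA⟩ := sum_prodP_le_of_mem_window hpos hκ0 hδ0 hc hcf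
  obtain ⟨w, g, hw0, hg0, N, hN⟩ := exists_le_sum_prodP_window hpos hsum hmean hvar hκ0 hδ0 hcf b
  set q := Real.exp (a - c) with hq
  have hq0 : 0 < q := Real.exp_pos _
  have hq1 : q < 1 := Real.exp_lt_one_iff.2 (by linarith)
  have hlog : ∀ {n : ℕ} (x : Fin n → Fin d),
      -Real.log (prodP p x) = n * H + ∑ k, y (x k) := neg_log_prodP hpos
  have hexp : ∀ {n : ℕ} (x : Fin n → Fin d),
      prodP p x * Real.exp (-Real.log (prodP p x)) = 1 := fun x => by
    rw [Real.exp_neg, Real.exp_log (prodP_pos hpos x), mul_inv_cancel₀ (prodP_pos hpos x).ne']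
  refine ⟨max |Real.log g - w| |Real.log (A / (1 - q))|, max N 1, fun n hn => ?_⟩
  have hn1 : 1 ≤ n := (le_max_right _ _).trans hn
  have hn0 : (0 : ℝ) < n := by exact_mod_cast hn1
  have hs : 0 < √(n : ℝ) := Real.sqrt_pos.2 hn0
  set T := (n : ℝ) * H + √n * √(varH p) * PhiInv ε with hT
  have hTb : T = n * H + √n * b := by rw [hT, hb]; ring
  have hmem : ∀ k (x : Fin n → Fin d), x ∈ Rslab p ε c n k ↔
      -Real.log (prodP p x) ≤ T - c * k ∧ T - c * (k + 1) < -Real.log (prodP p x) := fun k x => by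
    simp [Rslab, hT, hH]
  have hterm : ∀ k : ℕ, ((Rslab p ε c n k).card : ℝ) * Real.exp (k * a)
      ≤ Real.exp T * (A / √n) * q ^ k := by
    intro k
    have h1 : ((Rslab p ε c n k).card : ℝ) ≤ Real.exp (T - c * k) * (A / √n) := by
      have h2 := hA n hn1 (√n * b - c * (k + 1)) (Rslab p ε c n k) fun x hx => by
        have := (hmem k x).1 hx
        rw [hlog, hTb] at this
        constructor <;> linarith [this.1, this.2]
      calc ((Rslab p ε c n k).card : ℝ)
          = ∑ x ∈ Rslab p ε c n k, prodP p x * Real.exp (-Real.log (prodP p x)) := by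
            simp [hexp]
        _ ≤ ∑ x ∈ Rslab p ε c n k, prodP p x * Real.exp (T - c * k) := by
            refine Finset.sum_le_sum fun x hx => ?_
            have := prodP_pos hpos x
            gcongr
            exact ((hmem k x).1 hx).1
        _ = Real.exp (T - c * k) * ∑ x ∈ Rslab p ε c n k, prodP p x := by
            rw [← Finset.sum_mul, mul_comm]
        _ ≤ _ := by gcongr
    calc _ ≤ Real.exp (T - c * k) * (A / √n) * Real.exp (k * a) := by gcongr
      _ = _ := by
        have : Real.exp (T - c * k) * Real.exp (k * a) = Real.exp T * q ^ k := by
          rw [hq, ← Real.exp_nat_mul, ← Real.exp_add, ← Real.exp_add]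
          congr 1
          ring
        linear_combination (A / √n) * this
  have hgeo := (summable_geometric_of_lt_one hq0.le hq1).mul_left (Real.exp T * (A / √n))
  have hnn : ∀ k : ℕ, 0 ≤ ((Rslab p ε c n k).card : ℝ) * Real.exp (k * a) := fun k => by positivity
  have hsummable := Summable.of_nonneg_of_le hnn hterm hgeo
  set S := ∑' k : ℕ, ((Rslab p ε c n k).card : ℝ) * Real.exp (k * a) with hS
  have hupper : S ≤ Real.exp T * (A / (1 - q)) / √n := by
    refine (hsummable.tsum_le_tsum hterm hgeo).trans_eq ?_
    rw [tsum_mul_left, tsum_geometric_of_lt_one hq0.le hq1]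
    ring
  have hlower : Real.exp T * (g * Real.exp (-w)) / √n ≤ S := by
    set s : Finset (Fin n → Fin d) :=
      {x | √n * b - w ≤ ∑ k, y (x k) ∧ ∑ k, y (x k) ≤ √n * b} with hsdef
    have hg : g / √n ≤ ∑ x ∈ s, prodP p x := hN n ((le_max_left _ _).trans hn)
    have hcard : Real.exp (T - w) * (g / √n) ≤ s.card := by
      calc _ ≤ Real.exp (T - w) * ∑ x ∈ s, prodP p x := by gcongr
        _ = ∑ x ∈ s, prodP p x * Real.exp (T - w) := by rw [← Finset.sum_mul, mul_comm]
        _ ≤ ∑ x ∈ s, prodP p x * Real.exp (-Real.log (prodP p x)) := by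
            refine Finset.sum_le_sum fun x hx => ?_
            have := prodP_pos hpos x
            gcongr
            rw [hlog, hTb]
            linarith [(Finset.mem_filter.1 hx).2.1]
        _ = s.card := by simp [hexp]
    set M := ⌊w / c⌋₊ + 1 with hM
    have hsub : s ⊆ (Finset.range M).biUnion fun k => Rslab p ε c n k := by
      intro x hx
      obtain ⟨-, h1, h2⟩ := Finset.mem_filter.1 hx
      have h0 : 0 ≤ (√n * b - ∑ k, y (x k)) / c := div_nonneg (by linarith) hc.le
      have hfl := Nat.floor_le h0
      have hlt := Nat.lt_floor_add_one ((√n * b - ∑ k, y (x k)) / c)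
      rw [le_div_iff₀ hc] at hfl
      rw [div_lt_iff₀ hc] at hlt
      refine Finset.mem_biUnion.2 ⟨⌊(√n * b - ∑ k, y (x k)) / c⌋₊, ?_, ?_⟩
      · rw [Finset.mem_range, hM, Nat.lt_succ_iff]
        refine Nat.floor_mono ?_
        gcongr
        linarith
      · rw [hmem, hlog, hTb]
        constructor <;> linarith
    have hcardle : (s.card : ℝ) ≤ ∑ k ∈ Finset.range M, ((Rslab p ε c n k).card : ℝ) := by
      exact_mod_cast (Finset.card_le_card hsub).trans Finset.card_biUnion_le
    calc Real.exp T * (g * Real.exp (-w)) / √n = Real.exp (T - w) * (g / √n) := by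
          rw [sub_eq_add_neg, Real.exp_add T]
          ring
      _ ≤ s.card := hcard
      _ ≤ ∑ k ∈ Finset.range M, ((Rslab p ε c n k).card : ℝ) := hcardle
      _ ≤ ∑ k ∈ Finset.range M, ((Rslab p ε c n k).card : ℝ) * Real.exp (k * a) :=
          Finset.sum_le_sum fun k _ => le_mul_of_one_le_right (Nat.cast_nonneg _)
            (Real.one_le_exp (by positivity))
      _ ≤ S := hsummable.sum_le_tsum _ fun k _ => hnn k
  have hq1' : 0 < 1 - q := by linarith
  have hS0 : 0 < S := lt_of_lt_of_le (by positivity) hlower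
  have hlogs : Real.log √n = 1 / 2 * Real.log n := by rw [Real.log_sqrt hn0.le]; ring
  have hup := Real.log_le_log hS0 hupper
  have hlo := Real.log_le_log (by positivity) hlower
  rw [Real.log_div (by positivity) hs.ne', Real.log_mul (by positivity) (by positivity),
    Real.log_exp, hlogs] at hup hlo
  rw [Real.log_mul hg0.ne' (by positivity), Real.log_exp] at hlo
  rw [abs_le]
  constructor
  · have := (neg_abs_le (Real.log g - w)).trans' (neg_le_neg (le_max_left _
      |Real.log (A / (1 - q))|))
    linarith
  · have := (le_abs_self (Real.log (A / (1 - q)))).trans (le_max_right |Real.log g - w| _)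
    linarith
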